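/- Let n be a nonnegative integer and let a, b, c ∈ ℂ with b ≠ 1/2 and a ≠ −1/2. Set w = (c+bn)/(1−2b), and assume c+bn ≠ 0, c + j ≠ 0 for 0 ≤ j ≤ max(n−1, ⌊n/2⌋), w + j ≠ 0 for 0 ≤ j ≤ ⌊n/2⌋−1, and 1−c−n+j ≠ 0 for 0 ≤ j ≤ ⌊n/2⌋−1. Then Σ_{k=0}^{⌊n/2⌋} (−n/2)_k ((1−n)/2)_k (1+w)_k (−a)_k (a+1)_k / ((3/2)_k (w)_k (c+1)_k (1−c−n)_k · k!) = (c(c+a+b(n+1)) / ((n+1)(2a+1)(c+bn))) · (c+a+1)_n/(c)_n − (c(c−a−1+b(n+1)) / ((n+1)(2a+1)(c+bn))) · (c−a)_n/(c)_n. (Terminating balanced series identity with free parameter b; the left-hand side is ₅F₄[−n/2, (1−n)/2, 1+(c+bn)/(1−2b), −a, a+1; 3/2, (c+bn)/(1−2b), c+1, 1−c−n; 1].) -/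

import Mathlib

/-- Rising factorial (Pochhammer symbol) of a complex number:
`poch x 0 = 1` and `poch x (m+1) = poch x m * (x + m)`. -/
noncomputable def poch (x : ℂ) : ℕ → ℂ
  | 0 => 1
  | m + 1 => poch x m * (x + (m : ℂ))

lemma poch_add (x : ℂ) (m k : ℕ) : poch x (m + k) = poch x m * poch (x + m) k := by
  induction k with
  | zero => simp [poch]
  | succ k ih =>
    rw [← add_assoc, poch, poch, ih]; push_cast; ring

lemma poch_succ_left (x : ℂ) (k : ℕ) : poch x (k + 1) = x * poch (x + 1) k := by
  rw [add_comm, poch_add]; simp [poch]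

lemma poch_ne_zero (x : ℂ) (k : ℕ) (h : ∀ j : ℕ, j < k → x + (j : ℂ) ≠ 0) : poch x k ≠ 0 := by
  induction k with
  | zero => simp [poch]
  | succ k ih =>
    rw [poch]
    exact mul_ne_zero (ih fun j hj => h j (by omega)) (h k (by omega))

lemma poch_shift (w : ℂ) (k : ℕ) : poch (1 + w) k * w = poch w k * (w + k) := by
  have h := poch_succ_left w k
  rw [poch] at h
  rw [h, add_comm 1 w]; ring

lemma choose_step (N k : ℕ) :
    ((N.choose (k + 1) : ℕ) : ℂ) * (k + 1) = (N.choose k : ℂ) * ((N : ℂ) - k) := by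
  rcases le_or_gt k N with h | h
  · have := Nat.choose_succ_right_eq N k
    rw [← Nat.cast_sub h]
    exact_mod_cast this
  · rw [Nat.choose_eq_zero_of_lt h, Nat.choose_eq_zero_of_lt (by omega : N < k + 1)]; simp

/-- the factor `P_k` -/
noncomputable def pk (a : ℂ) (k : ℕ) : ℂ := (-1) ^ k * (poch (-a) k * poch (a + 1) k)

lemma pk_succ (a : ℂ) (k : ℕ) :
    pk a (k + 1) = pk a k * (a * (a + 1) - k * (k + 1)) := by
  simp only [pk, poch, pow_succ]; ring

/-- the coefficient of `P_k` -/
noncomputable def tk (N : ℕ) (c : ℂ) (k : ℕ) : ℂ :=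
  (N.choose (2 * k + 1) : ℂ) * poch (c + k) (N - 1 - 2 * k)

lemma key (N k : ℕ) (c : ℂ) :
    (((N + 1).choose (2 * k + 1) : ℂ) + (N.choose (2 * k) : ℂ)) * poch (c + k) (N + 1 - 2 * k)
      = (2 * c + N) * tk (N + 1) c k + (k * (k + 1) - c ^ 2 + c) * tk N (c + 1) k := by
  unfold tk
  rcases lt_trichotomy N (2 * k) with h | h | h
  · rw [Nat.choose_eq_zero_of_lt h, Nat.choose_eq_zero_of_lt (by omega : N < 2 * k + 1),
      Nat.choose_eq_zero_of_lt (by omega : N + 1 < 2 * k + 1)]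
    simp
  · subst h
    have e1 : 2 * k + 1 - 2 * k = 1 := by omega
    have e2 : 2 * k + 1 - 1 - 2 * k = 0 := by omega
    rw [e1, e2, Nat.choose_eq_zero_of_lt (by omega : 2 * k < 2 * k + 1)]
    simp [poch]; ring
  · obtain ⟨m, rfl⟩ : ∃ m, N = 2 * k + 1 + m := ⟨N - (2 * k + 1), by omega⟩
    have e1 : 2 * k + 1 + m + 1 - 2 * k = m + 1 + 1 := by omega
    have e2 : 2 * k + 1 + m + 1 - 1 - 2 * k = m + 1 := by omega
    have e3 : 2 * k + 1 + m - 1 - 2 * k = m := by omega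
    have hs := choose_step (2 * k + 1 + m) (2 * k)
    rw [e1, e2, e3, poch, poch_succ_left, Nat.choose_succ_succ' (2 * k + 1 + m) (2 * k)]
    rw [show c + 1 + (k : ℂ) = c + k + 1 by ring]
    push_cast at hs ⊢
    linear_combination (-(c + k) * poch (c + k + 1) m) * hs

lemma tk_zero (N : ℕ) (c : ℂ) :
    tk (N + 2) c 0 = (2 * c + N) * tk (N + 1) c 0 + (-c ^ 2 + c) * tk N (c + 1) 0 := by
  have h := key N 0 c
  have e : tk (N + 2) c 0 = ((N + 2 : ℕ) : ℂ) * poch c (N + 1) := by simp [tk]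
  rw [e]
  simp at h
  push_cast
  linear_combination h

lemma tk_succ (N k : ℕ) (c : ℂ) :
    tk (N + 2) c (k + 1) = (2 * c + N) * tk (N + 1) c (k + 1)
      + ((k + 1) * (k + 2) - c ^ 2 + c) * tk N (c + 1) (k + 1) + tk N (c + 1) k := by
  have h := key N (k + 1) c
  have e : tk (N + 2) c (k + 1) = (((N + 1).choose (2 * (k + 1) + 1) : ℂ) +
      (N.choose (2 * (k + 1)) : ℂ)) * poch (c + (k + 1 : ℕ)) (N + 1 - 2 * (k + 1))
      + tk N (c + 1) k := by
    unfold tk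
    rw [show N + 2 - 1 - 2 * (k + 1) = N - 1 - 2 * k by omega,
      show N + 1 - 2 * (k + 1) = N - 1 - 2 * k by omega,
      Nat.choose_succ_succ' (N + 1) (2 * (k + 1)),
      show 2 * (k + 1) = 2 * k + 1 + 1 by ring, Nat.choose_succ_succ' N (2 * k + 1)]
    rw [show c + 1 + (k : ℂ) = c + (k + 1 : ℕ) by push_cast; ring]
    push_cast; ring
  rw [e, h]; push_cast; ring

lemma sum_rec (N M : ℕ) (a c : ℂ) :
    ∑ k ∈ Finset.range (M + 1), tk (N + 2) c k * pk a k =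
      (2 * c + N) * ∑ k ∈ Finset.range (M + 1), tk (N + 1) c k * pk a k
      + (a * (a + 1) - c ^ 2 + c) * ∑ k ∈ Finset.range (M + 1), tk N (c + 1) k * pk a k
      - tk N (c + 1) M * pk a (M + 1) := by
  induction M with
  | zero => simp [tk_zero, pk_succ]; ring
  | succ M ih =>
    rw [Finset.sum_range_succ, ih, tk_succ, Finset.sum_range_succ _ (M + 1),
      Finset.sum_range_succ (fun k => tk N (c + 1) k * pk a k) (M + 1), pk_succ a (M + 1)]
    push_cast; ring

lemma D_rec (N : ℕ) (a c : ℂ) :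
    poch (c + a) (N + 2) - poch (c - a - 1) (N + 2) =
      (2 * c + N) * (poch (c + a) (N + 1) - poch (c - a - 1) (N + 1))
      + (a * (a + 1) - c ^ 2 + c) * (poch (c + 1 + a) N - poch (c + 1 - a - 1) N) := by
  rw [poch_succ_left (c + a) (N + 1), poch_succ_left (c - a - 1) (N + 1),
    poch_succ_left (c + a) N, poch_succ_left (c - a - 1) N, poch, poch,
    show c + 1 + a = c + a + 1 by ring, show c + 1 - a - 1 = c - a - 1 + 1 by ring]
  ring

lemma main_sum (a : ℂ) (N : ℕ) : ∀ (M : ℕ) (c : ℂ), N ≤ 2 * M →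
    (2 * a + 1) * ∑ k ∈ Finset.range M, tk N c k * pk a k
      = poch (c + a) N - poch (c - a - 1) N := by
  induction N using Nat.twoStepInduction with
  | zero => intro M c _; simp [tk, poch]
  | one =>
    intro M c h
    obtain ⟨M, rfl⟩ : ∃ m, M = m + 1 := ⟨M - 1, by omega⟩
    rw [Finset.sum_range_succ', Finset.sum_eq_zero]
    · simp [tk, poch, pk]; ring
    · intro k _
      simp [tk, Nat.choose_eq_zero_of_lt (by omega : 1 < 2 * (k + 1) + 1)]
  | more N ih0 ih1 =>
    intro M c h
    obtain ⟨M, rfl⟩ : ∃ m, M = m + 1 := ⟨M - 1, by omega⟩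
    have hz : tk N (c + 1) M = 0 := by
      simp [tk, Nat.choose_eq_zero_of_lt (by omega : N < 2 * M + 1)]
    rw [sum_rec, hz, D_rec, ← ih0 (M + 1) (c + 1) (by omega), ← ih1 (M + 1) c (by omega)]
    ring

lemma half_poch (n k : ℕ) :
    poch (-(n : ℂ) / 2) k * poch ((1 - (n : ℂ)) / 2) k * (n + 1)
      = ((n + 1).choose (2 * k + 1) : ℂ) * (poch (3 / 2) k * (Nat.factorial k : ℂ)) := by
  induction k with
  | zero => simp [poch]
  | succ k ih =>
    have h1 := choose_step (n + 1) (2 * k + 1)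
    have h2 := choose_step (n + 1) (2 * k + 1 + 1)
    rw [show 2 * (k + 1) + 1 = 2 * k + 1 + 1 + 1 by ring]
    simp only [poch, Nat.factorial_succ]
    push_cast at h1 h2 ⊢
    set C1 : ℂ := ((n + 1).choose (2 * k + 1) : ℂ)
    set C2 : ℂ := ((n + 1).choose (2 * k + 1 + 1) : ℂ)
    set C3 : ℂ := ((n + 1).choose (2 * k + 1 + 1 + 1) : ℂ)
    set F : ℂ := poch (3 / 2) k * (Nat.factorial k : ℂ) with hF
    have h3 : C3 * (3 / 2 + k) * (k + 1) = C1 * (-(n : ℂ) / 2 + k) * ((1 - n) / 2 + k) := by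
      linear_combination (k + 1) / 2 * h2 + ((n : ℂ) - 2 * k - 1) / 4 * h1
    linear_combination (-(n : ℂ) / 2 + k) * ((1 - n) / 2 + k) * ih - F * h3

lemma poch_reflect (n k : ℕ) (c : ℂ) (h : k ≤ n) :
    poch (1 - c - n) k * poch c (n - k) = (-1) ^ k * poch c n := by
  induction k with
  | zero => simp [poch]
  | succ k ih =>
    rw [← mul_one ((-1 : ℂ) ^ (k + 1)), pow_succ]
    have ih := ih (by omega)
    obtain ⟨m, rfl⟩ : ∃ m, n = m + (k + 1) := ⟨n - (k + 1), by omega⟩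
    rw [show m + (k + 1) - k = m + 1 by omega, poch] at ih
    rw [show m + (k + 1) - (k + 1) = m by omega, poch]
    push_cast at ih ⊢
    linear_combination (-1) * ih

lemma split_term (n k : ℕ) (b c : ℂ) (h : 2 * k ≤ n) :
    poch c (n - k) * (c + k + b * (n - 2 * k)) = poch c (k + 1) *
      (poch (c + k) (n - 2 * k) + b * (n - 2 * k) * poch (c + 1 + k) (n - 1 - 2 * k)) := by
  obtain ⟨m, rfl⟩ : ∃ m, n = 2 * k + m := ⟨n - 2 * k, by omega⟩
  cases m with
  | zero =>
    rw [show 2 * k + 0 - k = k by omega, show 2 * k + 0 - 2 * k = 0 by omega]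
    simp [poch]
  | succ m =>
    rw [show 2 * k + (m + 1) - k = k + 1 + m by omega,
      show 2 * k + (m + 1) - 2 * k = m + 1 by omega,
      show 2 * k + (m + 1) - 1 - 2 * k = m by omega, poch_add c (k + 1) m, poch_succ_left (c + k)]
    rw [show c + 1 + (k : ℂ) = c + k + 1 by ring]
    push_cast
    rw [show c + ((k : ℂ) + 1) = c + k + 1 by ring]
    ring

lemma choose_b (n k : ℕ) :
    ((n + 1).choose (2 * k + 1) : ℂ) * (n - 2 * k) = (n + 1) * (n.choose (2 * k + 1) : ℂ) := by
  have h1 := choose_step n (2 * k)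
  have h2 := Nat.choose_succ_succ' n (2 * k)
  have h3 := Nat.add_one_mul_choose_eq n (2 * k)
  rw [h2]
  push_cast at h1 ⊢
  linear_combination (-1) * h1

/-- Terminating balanced series identity with free parameter `b`
(second Hagen–Rothe proposition). -/
theorem hr_balanced_second (n : ℕ) (a b c : ℂ) (hb : b ≠ 1 / 2) (ha : a ≠ -(1 / 2)) (w : ℂ)
    (hw : w = (c + b * (n : ℂ)) / (1 - 2 * b))
    (hcbn : c + b * (n : ℂ) ≠ 0)
    (hc : ∀ j : ℕ, j ≤ max (n - 1) (n / 2) → c + (j : ℂ) ≠ 0)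
    (hwj : ∀ j : ℕ, j < n / 2 → w + (j : ℂ) ≠ 0)
    (hcn : ∀ j : ℕ, j < n / 2 → 1 - c - (n : ℂ) + (j : ℂ) ≠ 0) :
    ∑ k ∈ Finset.range (n / 2 + 1),
      poch (-(n : ℂ) / 2) k * poch ((1 - (n : ℂ)) / 2) k * poch (1 + w) k *
        poch (-a) k * poch (a + 1) k /
        (poch (3 / 2) k * poch w k * poch (c + 1) k * poch (1 - c - (n : ℂ)) k *
          (Nat.factorial k : ℂ)) =
      (c * (c + a + b * ((n : ℂ) + 1)) /
          (((n : ℂ) + 1) * (2 * a + 1) * (c + b * (n : ℂ)))) *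
          (poch (c + a + 1) n / poch c n) -
        (c * (c - a - 1 + b * ((n : ℂ) + 1)) /
          (((n : ℂ) + 1) * (2 * a + 1) * (c + b * (n : ℂ)))) *
          (poch (c - a) n / poch c n) := by
  
  have hb' : 1 - 2 * b ≠ 0 := fun h => hb (by linear_combination (-1 / 2) * h)
  have ha' : 2 * a + 1 ≠ 0 := fun h => ha (by linear_combination (1 / 2) * h)
  have hn : (n : ℂ) + 1 ≠ 0 := by exact_mod_cast Nat.succ_ne_zero n
  have hw0 : w ≠ 0 := by rw [hw]; exact div_ne_zero hcbn hb'
  have hwe : w * (1 - 2 * b) = c + b * n := by rw [hw]; exact div_mul_cancel₀ _ hb'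
  have hcn0 : poch c n ≠ 0 := poch_ne_zero _ _ fun j hj => hc j (by omega)
  have hc0 : c ≠ 0 := by simpa using hc 0 (by omega)
  have hterm : ∀ k ∈ Finset.range (n / 2 + 1),
      poch (-(n : ℂ) / 2) k * poch ((1 - (n : ℂ)) / 2) k * poch (1 + w) k *
        poch (-a) k * poch (a + 1) k /
        (poch (3 / 2) k * poch w k * poch (c + 1) k * poch (1 - c - (n : ℂ)) k *
          (Nat.factorial k : ℂ)) =
      c / ((n + 1) * (c + b * n) * poch c n) *
        (tk (n + 1) c k * pk a k + b * (n + 1) * (tk n (c + 1) k * pk a k)) := by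
    intro k hk
    have hk : k ≤ n / 2 := by simpa [Nat.lt_succ_iff] using hk
    have n1 : poch (3 / 2) k ≠ 0 := poch_ne_zero _ _ fun j _ h => by
      have h' : ((3 + 2 * j : ℕ) : ℂ) = 0 := by push_cast; linear_combination 2 * h
      have := Nat.cast_eq_zero.mp h'
      omega
    have n2 : poch w k ≠ 0 := poch_ne_zero _ _ fun j hj => hwj j (by omega)
    have n3 : poch (1 - c - (n : ℂ)) k ≠ 0 := poch_ne_zero _ _ fun j hj => hcn j (by omega)
    have n4 : poch c (k + 1) ≠ 0 := poch_ne_zero _ _ fun j hj => hc j (by omega)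
    have n5 : poch (c + 1) k ≠ 0 := by
      rw [poch_succ_left] at n4; exact right_ne_zero_of_mul n4
    have n6 : (Nat.factorial k : ℂ) ≠ 0 := by exact_mod_cast Nat.factorial_ne_zero k
    have e1 := half_poch n k
    have e2 := poch_shift w k
    have e3 := poch_reflect n k c (by omega)
    have e4 := split_term n k b c (by omega)
    have e5 := choose_b n k
    rw [poch_succ_left] at e4
    have e6 : tk (n + 1) c k * pk a k + b * (n + 1) * (tk n (c + 1) k * pk a k)
        = ((n + 1).choose (2 * k + 1) : ℂ) * pk a k * (poch (c + k) (n - 2 * k)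
          + b * (n - 2 * k) * poch (c + 1 + k) (n - 1 - 2 * k)) := by
      unfold tk
      rw [show n + 1 - 1 - 2 * k = n - 2 * k by omega]
      linear_combination (-b * pk a k * poch (c + 1 + k) (n - 1 - 2 * k)) * e5
    rw [e6]
    set R := poch (c + k) (n - 2 * k) + b * (n - 2 * k) * poch (c + 1 + k) (n - 1 - 2 * k)
    have f1 : poch (-(n : ℂ) / 2) k * poch ((1 - (n : ℂ)) / 2) k =
        ((n + 1).choose (2 * k + 1) : ℂ) * (poch (3 / 2) k * (Nat.factorial k : ℂ)) / (n + 1) := by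
      rw [eq_div_iff hn, e1]
    have f2 : poch (1 + w) k = poch w k * (c + k + b * (n - 2 * k)) / (c + b * n) := by
      rw [eq_div_iff hcbn, ← hwe]
      linear_combination (1 - 2 * b) * e2 + poch w k * hwe
    have hs : ((-1 : ℂ) ^ k) * (-1) ^ k = 1 := by rw [← mul_pow]; simp
    have f3 : poch c (n - k) = (-1) ^ k * poch c n / poch (1 - c - (n : ℂ)) k := by
      rw [eq_div_iff n3, ← e3]; ring
    rw [f3] at e4
    have f4 : R = (-1) ^ k * poch c n / poch (1 - c - (n : ℂ)) k * (c + k + b * (n - 2 * k))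
        / (c * poch (c + 1) k) := by
      rw [eq_div_iff (mul_ne_zero hc0 n5), e4]; ring
    rw [f1, f2, f4, pk]
    generalize (-1 : ℂ) ^ k = s at hs
    field_simp
    linear_combination (-(((n + 1).choose (2 * k + 1) : ℂ) * (c + k + b * (n - 2 * k)) *
      poch (-a) k * poch (a + 1) k / (c + b * n))) * hs
  rw [Finset.sum_congr rfl hterm, ← Finset.mul_sum, Finset.sum_add_distrib, ← Finset.mul_sum]
  have s1 := main_sum a (n + 1) (n / 2 + 1) c (by omega)
  have s2 := main_sum a n (n / 2 + 1) (c + 1) (by omega)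
  rw [poch_succ_left, poch_succ_left, show c - a - 1 + 1 = c - a by ring] at s1
  rw [show c + 1 - a - 1 = c - a by ring, show c + 1 + a = c + a + 1 by ring] at s2
  rw [mul_comm, ← eq_div_iff ha'] at s1 s2
  rw [s1, s2]
  field_simp
  ring
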